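/- Theorem 4 (the multi-path bound of He et al. [DATE 2023]). Let G = (V, E) be a DAG task with weight function c, let m ≥ 1 be an integer number of cores, and let (P_i)_{i=0}^{k} be a generalized path list with 0 ≤ k ≤ m − 1. Then for every execution sequence of G on m cores, the response time satisfies R ≤ len(G) + vol(G) − Σ_{i=0}^{k} len(P_i). -/

import Mathlib

/-! STATEMENT 2: Theorem 4, the multi-path bound of He et al. [DATE 2023]. -/

noncomputable section

variable {V : Type*}

/-- `P` is a generalized path: its elements are pairwise comparable
under the ancestor relation (the transitive closure of the edge relation `E`). -/
def IsGenPath (E : V → V → Prop) (P : Finset V) : Prop :=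
  ∀ u ∈ P, ∀ v ∈ P, u ≠ v → Relation.TransGen E u v ∨ Relation.TransGen E v u

/-- The length of a (generalized) path: total weight of its vertices. -/
def pathLen (c : V → ℝ) (P : Finset V) : ℝ := ∑ v ∈ P, c v

/-- The volume of the DAG: total weight of all vertices. -/
def dagVol [Fintype V] (c : V → ℝ) : ℝ := ∑ v : V, c v

/-- `len(G)`: the maximum length of a generalized path of the DAG. -/
def dagLen [Fintype V] (E : V → V → Prop) (c : V → ℝ) : ℝ :=
  sSup { x : ℝ | ∃ P : Finset V, IsGenPath E P ∧ x = pathLen c P }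

open MeasureTheory Relation

/-- The set of vertices executing at time `t`. -/
def executing (s e : V → ℝ) (t : ℝ) : Set V := {v | s v ≤ t ∧ t < s v + e v}

/-- The set of times at which some vertex outside `U` is executing. -/
def busyOutside (s e : V → ℝ) (U : Finset V) : Set ℝ :=
  {t | ∃ v, v ∉ U ∧ v ∈ executing s e t}

lemma finish_le_start_of_transGen {E : V → V → Prop} {s e : V → ℝ} (he0 : ∀ v, 0 ≤ e v)
    (hprec : ∀ u v, E u v → s u + e u ≤ s v) {u v : V} (h : TransGen E u v) :
    s u + e u ≤ s v := by
  induction h with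
  | single h => exact hprec _ _ h
  | @tail w _ _ h ih => linarith [hprec _ _ h, he0 w]

lemma wellFounded_transGen_of_acyclic [Finite V] {E : V → V → Prop}
    (hacyc : ∀ v, ¬ TransGen E v v) : WellFounded (TransGen E) := by
  have : Std.Irrefl (TransGen E) := ⟨hacyc⟩
  exact Finite.wellFounded_of_trans_of_irrefl (TransGen E)

/-- While `v` is unfinished, `v` or an ancestor of `v` is executing, or all cores are busy. -/
lemma exists_executing_ancestor_or_ncard_eq [Finite V] {E : V → V → Prop}
    (hacyc : ∀ v, ¬ TransGen E v v) {s e : V → ℝ} {m : ℕ} {t : ℝ}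
    (hwc : (∃ v, t < s v ∧ ∀ u, E u v → s u + e u ≤ t) → (executing s e t).ncard = m)
    (v : V) (hv : t < s v + e v) :
    (∃ u, ReflTransGen E u v ∧ u ∈ executing s e t) ∨ (executing s e t).ncard = m := by
  induction v using (wellFounded_transGen_of_acyclic hacyc).induction with
  | _ v ih =>
    by_cases hs : s v ≤ t
    · exact .inl ⟨v, .refl, hs, hv⟩
    by_cases hpred : ∀ u, E u v → s u + e u ≤ t
    · exact .inr (hwc ⟨v, not_le.mp hs, hpred⟩)
    push Not at hpred
    obtain ⟨u, huv, hu⟩ := hpred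
    exact (ih u (.single huv) hu).imp_left fun ⟨w, hw, hwt⟩ => ⟨w, hw.tail huv, hwt⟩

/-- If all `m` cores execute vertices covered by at most `m` generalized paths, then each of these
paths has an executing vertex. -/
lemma exists_mem_executing_of_ncard_eq [Finite V] {E : V → V → Prop} {s e : V → ℝ}
    (he0 : ∀ v, 0 ≤ e v) (hprec : ∀ u v, E u v → s u + e u ≤ s v) {k m : ℕ} (hkm : k + 1 ≤ m)
    {P : ℕ → Finset V} (hP : ∀ i ≤ k, IsGenPath E (P i)) {t : ℝ}
    (hcard : (executing s e t).ncard = m)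
    (hcov : ∀ v ∈ executing s e t, ∃ i ≤ k, v ∈ P i) {j : ℕ} (hj : j ≤ k) :
    ∃ x ∈ P j, x ∈ executing s e t := by
  classical
  choose! g hgk hgP using hcov
  have hinj : Set.InjOn g (executing s e t) := by
    intro u hu v hv huv
    by_contra hne
    rcases hP _ (hgk u hu) u (hgP u hu) v (huv ▸ hgP v hv) hne with h | h
    · linarith [finish_le_start_of_transGen he0 hprec h, hu.2, hv.1]
    · linarith [finish_le_start_of_transGen he0 hprec h, hv.2, hu.1]
  have himage : g '' executing s e t = Set.Iic k := by
    refine Set.eq_of_subset_of_ncard_le ?_ ?_ (Set.finite_Iic k)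
    · rintro _ ⟨v, hv, rfl⟩
      exact hgk v hv
    · rw [hinj.ncard_image, hcard, Set.ncard_eq_toFinset_card']
      simpa using hkm
  obtain ⟨x, hx, rfl⟩ : j ∈ g '' executing s e t := himage ▸ hj
  exact ⟨x, hgP x hx, hx⟩

lemma volume_busyOutside_le [Fintype V] {s e : V → ℝ} (he0 : ∀ v, 0 ≤ e v)
    (U : Finset V) [DecidableEq V] :
    volume (busyOutside s e U) ≤ ENNReal.ofReal (∑ v ∈ Uᶜ, e v) := by
  have heq : busyOutside s e U = ⋃ v ∈ Uᶜ, Set.Ico (s v) (s v + e v) := by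
    ext t
    simp [busyOutside, executing, and_left_comm]
  rw [heq, ENNReal.ofReal_sum_of_nonneg fun v _ => he0 v]
  refine (measure_biUnion_finset_le _ _).trans (Finset.sum_le_sum fun v _ => ?_)
  simp

lemma volume_real_inter_Iio_add_le {Z : Set ℝ} (hZ : volume Z ≠ ⊤) {a b : ℝ} (hab : a ≤ b)
    (h : Set.Ico a b ⊆ Z) :
    volume.real (Z ∩ Set.Iio a) + (b - a) ≤ volume.real (Z ∩ Set.Iio b) := by
  have hfin : volume (Z ∩ Set.Iio b) ≠ ⊤ := measure_ne_top_of_subset Set.inter_subset_left hZ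
  have hfin' : volume (Z ∩ Set.Iio a) ≠ ⊤ := measure_ne_top_of_subset Set.inter_subset_left hZ
  have hdisj : Disjoint (Z ∩ Set.Iio a) (Set.Ico a b) :=
    Set.disjoint_left.mpr fun t ht ht' => (not_lt.mpr ht'.1) ht.2
  have hunion := measureReal_union (μ := volume) hdisj measurableSet_Ico hfin' (by simp)
  rw [Real.volume_real_Ico_of_le hab] at hunion
  rw [← hunion]
  refine measureReal_mono (Set.union_subset ?_ fun t ht => ⟨h ht, ht.2⟩) hfin
  exact fun t ht => ⟨ht.1, lt_of_lt_of_le ht.2 hab⟩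

lemma IsGenPath.insert_of_transGen [DecidableEq V] {E : V → V → Prop} {C : Finset V} {u : V}
    (hC : IsGenPath E C) (hCu : ∀ x ∈ C, TransGen E x u) : IsGenPath E (insert u C) := by
  intro x hx y hy hxy
  rcases Finset.mem_insert.mp hx with rfl | hxC <;>
    rcases Finset.mem_insert.mp hy with rfl | hyC
  · exact absurd rfl hxy
  · exact .inr (hCu y hyC)
  · exact .inl (hCu x hxC)
  · exact hC x hxC y hyC hxy

/-- A bound on the start time of `u` yields a bound on its finish time. -/
lemma finish_le_of_start_le [DecidableEq V] {c s e : V → ℝ} {Z : Set ℝ} (hZ : volume Z ≠ ⊤)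
    {C : Finset V} {u : V} (he0 : 0 ≤ e u) (hec : e u ≤ c u) (hnot : u ∉ C)
    (hle : s u ≤ volume.real (Z ∩ Set.Iio (s u)) + pathLen c C) :
    s u + e u ≤ volume.real (Z ∩ Set.Iio (s u + e u)) + pathLen c (insert u C) := by
  have hmono : volume.real (Z ∩ Set.Iio (s u)) ≤ volume.real (Z ∩ Set.Iio (s u + e u)) :=
    measureReal_mono (Set.inter_subset_inter_right _ (Set.Iio_subset_Iio (by linarith)))
      (measure_ne_top_of_subset Set.inter_subset_left hZ)
  simp only [pathLen, Finset.sum_insert hnot] at hle ⊢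
  linarith

/-- Suppose that before the start of any vertex of `U`, at each time either a vertex outside `U` or
an ancestor in `U` is executing. Then the start time of a vertex of `U` is at most the time spent
executing vertices outside `U` plus the length of some generalized path of ancestors. -/
lemma exists_genPath_start_le [Finite V] {E : V → V → Prop} (hacyc : ∀ v, ¬ TransGen E v v)
    {c s e : V → ℝ} (hs : ∀ v, 0 ≤ s v) (he0 : ∀ v, 0 ≤ e v) (hec : ∀ v, e v ≤ c v)
    (hprec : ∀ u v, E u v → s u + e u ≤ s v) {U : Finset V}
    (hZ : volume (busyOutside s e U) ≠ ⊤)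
    (hcover : ∀ v ∈ U, ∀ t, 0 ≤ t → t < s v → t ∈ busyOutside s e U ∨
      ∃ u ∈ U, TransGen E u v ∧ u ∈ executing s e t) (v : V) (hv : v ∈ U) :
    ∃ C : Finset V, IsGenPath E C ∧ (∀ u ∈ C, TransGen E u v) ∧
      s v ≤ volume.real (busyOutside s e U ∩ Set.Iio (s v)) + pathLen c C := by
  classical
  induction v using (wellFounded_transGen_of_acyclic hacyc).induction with
  | _ v ih =>
    rcases (U.filter fun u => TransGen E u v).eq_empty_or_nonempty with hempty | hne
    · refine ⟨∅, by simp [IsGenPath], by simp, ?_⟩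
      have hsub : Set.Ico 0 (s v) ⊆ busyOutside s e U := by
        intro t ht
        refine (hcover v hv t ht.1 ht.2).resolve_right ?_
        rintro ⟨u, hu, huv, -⟩
        exact Finset.notMem_empty u (hempty ▸ Finset.mem_filter.mpr ⟨hu, huv⟩)
      have := volume_real_inter_Iio_add_le hZ (hs v) hsub
      have h0 : 0 ≤ volume.real (busyOutside s e U ∩ Set.Iio 0) := measureReal_nonneg
      simp only [pathLen, Finset.sum_empty]
      linarith
    · obtain ⟨u, hu, hmax⟩ := Finset.exists_max_image _ (fun u => s u + e u) hne
      obtain ⟨huU, huv⟩ := Finset.mem_filter.mp hu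
      obtain ⟨C, hC, hCu, hle⟩ := ih u huv huU
      refine ⟨insert u C, hC.insert_of_transGen hCu, ?_, ?_⟩
      · intro x hx
        rcases Finset.mem_insert.mp hx with rfl | hxC
        · exact huv
        · exact (hCu x hxC).trans huv
      · have hsub : Set.Ico (s u + e u) (s v) ⊆ busyOutside s e U := by
          intro t ht
          refine (hcover v hv t (by linarith [hs u, he0 u, ht.1]) ht.2).resolve_right ?_
          rintro ⟨w, hw, hwv, hwt⟩
          linarith [hmax w (Finset.mem_filter.mpr ⟨hw, hwv⟩), hwt.2, ht.1]
        have hstep := volume_real_inter_Iio_add_le hZ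
          (finish_le_start_of_transGen he0 hprec huv) hsub
        linarith [finish_le_of_start_le hZ (he0 u) (hec u) (fun h => hacyc u (hCu u h)) hle]

lemma pathLen_le_dagLen [Fintype V] {E : V → V → Prop} (c : V → ℝ) {C : Finset V}
    (hC : IsGenPath E C) : pathLen c C ≤ dagLen E c := by
  refine le_csSup (Set.Finite.bddAbove ((Set.finite_range (pathLen c)).subset ?_)) ⟨C, hC, rfl⟩
  rintro _ ⟨Q, -, rfl⟩
  exact ⟨Q, rfl⟩

theorem multi_path_bound_he_date2023
    [Fintype V] [Nonempty V]
    (E : V → V → Prop) (hacyc : ∀ v : V, ¬ Relation.TransGen E v v)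
    (c : V → ℝ) (hc : ∀ v, 0 ≤ c v)
    (m : ℕ) (hm : 1 ≤ m)
    (k : ℕ) (hk : k ≤ m - 1)
    -- generalized path list (P_i)_{i=0}^{k}
    (P : ℕ → Finset V)
    (hP : ∀ i ≤ k, IsGenPath E (P i))
    (hPdisj : ∀ i ≤ k, ∀ i' ≤ k, i ≠ i' → Disjoint (P i) (P i'))
    -- an execution sequence of G on m cores
    (s e : V → ℝ)
    (hs : ∀ v, 0 ≤ s v)
    (he0 : ∀ v, 0 ≤ e v) (hec : ∀ v, e v ≤ c v)
    (hprec : ∀ u v, E u v → s u + e u ≤ s v)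
    (hcore : ∀ t : ℝ, Set.ncard {v : V | s v ≤ t ∧ t < s v + e v} ≤ m)
    (hwc : ∀ t : ℝ, 0 ≤ t →
      (∃ v : V, t < s v ∧ ∀ u, E u v → s u + e u ≤ t) →
      Set.ncard {v : V | s v ≤ t ∧ t < s v + e v} = m) :
    -- R ≤ len(G) + vol(G) − Σ_{i=0}^{k} len(P_i)
    Finset.univ.sup' Finset.univ_nonempty (fun v => s v + e v) ≤
      dagLen E c + dagVol c - ∑ i ∈ Finset.range (k + 1), pathLen c (P i) := by
  classical
  set U : Finset V := (Finset.range (k + 1)).biUnion P with hU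
  have hmemU {v : V} : v ∈ U ↔ ∃ i ≤ k, v ∈ P i := by simp [hU]
  have hvol : dagVol c - ∑ i ∈ Finset.range (k + 1), pathLen c (P i) = ∑ v ∈ Uᶜ, c v := by
    have hsum : ∑ v ∈ U, c v = ∑ i ∈ Finset.range (k + 1), pathLen c (P i) :=
      Finset.sum_biUnion fun i hi j hj hij => hPdisj i (by simpa [Nat.lt_succ_iff] using hi) j
        (by simpa [Nat.lt_succ_iff] using hj) hij
    rw [dagVol, ← Finset.sum_add_sum_compl U c, hsum, add_sub_cancel_left]
  have hZle := volume_busyOutside_le (s := s) he0 U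
  have hZ : volume (busyOutside s e U) ≠ ⊤ := ne_top_of_le_ne_top ENNReal.ofReal_ne_top hZle
  have hunfinished (t : ℝ) (ht : 0 ≤ t) (v : V) (hv : t < s v + e v) :=
    exists_executing_ancestor_or_ncard_eq hacyc (hwc t ht) v hv
  have hcover : ∀ v ∈ U, ∀ t, 0 ≤ t → t < s v → t ∈ busyOutside s e U ∨
      ∃ u ∈ U, TransGen E u v ∧ u ∈ executing s e t := by
    intro v hv t ht htv
    by_cases hbusy : t ∈ busyOutside s e U
    · exact .inl hbusy
    have hin : ∀ u ∈ executing s e t, u ∈ U := fun u hu => by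
      by_contra h
      exact hbusy ⟨u, h, hu⟩
    right
    rcases hunfinished t ht v (by linarith [he0 v]) with ⟨u, huv, hu⟩ | hcard
    · rcases reflTransGen_iff_eq_or_transGen.mp huv with rfl | huv
      · exact absurd hu.1 (not_le.mpr htv)
      · exact ⟨u, hin u hu, huv, hu⟩
    · obtain ⟨j, hj, hvj⟩ := hmemU.mp hv
      obtain ⟨x, hxj, hx⟩ := exists_mem_executing_of_ncard_eq he0 hprec (by omega) hP hcard
        (fun u hu => hmemU.mp (hin u hu)) hj
      have hxv : x ≠ v := fun h => absurd (h ▸ hx.1) (not_le.mpr htv)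
      refine ⟨x, hin x hx, (hP j hj x hxj v hvj hxv).resolve_right fun h => ?_, hx⟩
      linarith [finish_le_start_of_transGen he0 hprec h, hx.1, he0 v]
  have hbound (T : ℝ) : volume.real (busyOutside s e U ∩ Set.Iio T) ≤ ∑ v ∈ Uᶜ, c v := by
    refine le_trans ?_ (Finset.sum_le_sum fun v _ => hec v)
    exact ENNReal.toReal_le_of_le_ofReal (Finset.sum_nonneg fun v _ => he0 v)
      ((measure_mono Set.inter_subset_left).trans hZle)
  refine Finset.sup'_le _ _ fun v _ => ?_
  rw [add_sub_assoc, hvol]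
  -- `F` bounds the finish times of `U`; a vertex outside `U` is executing from `F` on.
  suffices h : ∃ F, 0 ≤ F ∧ (∀ u ∈ U, s u + e u ≤ F) ∧
      F ≤ volume.real (busyOutside s e U ∩ Set.Iio F) + dagLen E c by
    obtain ⟨F, hF0, hF, hle⟩ := h
    rcases le_total (s v + e v) F with hvF | hvF
    · linarith [hbound F]
    have hsub : Set.Ico F (s v + e v) ⊆ busyOutside s e U := by
      intro t ht
      obtain ⟨u, hu⟩ : ∃ u, u ∈ executing s e t := by
        rcases hunfinished t (hF0.trans ht.1) v ht.2 with ⟨u, -, hu⟩ | hcard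
        · exact ⟨u, hu⟩
        · exact Set.nonempty_of_ncard_ne_zero (by omega)
      exact ⟨u, fun huU => by linarith [hF u huU, hu.2, ht.1], hu⟩
    linarith [volume_real_inter_Iio_add_le hZ hvF hsub, hbound (s v + e v)]
  rcases U.eq_empty_or_nonempty with hempty | hne
  · refine ⟨0, le_rfl, by simp [hempty], add_nonneg measureReal_nonneg ?_⟩
    simpa [pathLen] using pathLen_le_dagLen (E := E) c (C := ∅) (by simp [IsGenPath])
  · obtain ⟨u, hu, hmax⟩ := U.exists_max_image (fun u => s u + e u) hne
    refine ⟨s u + e u, add_nonneg (hs u) (he0 u), hmax, ?_⟩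
    obtain ⟨C, hC, hCu, hle⟩ := exists_genPath_start_le hacyc hs he0 hec hprec hZ hcover u hu
    linarith [pathLen_le_dagLen c (hC.insert_of_transGen hCu),
      finish_le_of_start_le hZ (he0 u) (hec u) (fun h => hacyc u (hCu u h)) hle]
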